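/- Let S = (1/3)·diag(1,1,1,0,0), S1 = (1/3)·[[1,0,0,1/2,0],[0,0,0,0,0],[0,0,−1,0,1/2],[1/2,0,0,0,0],[0,0,1/2,0,0]] and S2 = (1/3)·[[0,1,0,0,1/2],[1,0,1,−1/2,1/2],[0,1,0,1/2,0],[0,−1/2,1/2,0,0],[1/2,1/2,0,0,0]] be 5×5 complex matrices. Then for every e ∈ ℕ and all Hermitian (5+e)×(5+e) complex matrices 𝓛1, 𝓛2 satisfying S̃1 = (1/2)(S̃ 𝓛1 + 𝓛1 S̃) and S̃2 = (1/2)(S̃ 𝓛2 + 𝓛2 S̃), where S̃, S̃1, S̃2 are the zero-padded extensions of S, S1, S2 to size 5+e, one has 𝓛1 𝓛2 ≠ 𝓛2 𝓛1. -/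

import Mathlib

open Matrix

/-- The zero-padded extension of a `d × d` matrix to size `d + e`. -/
def zeroPad {d : ℕ} (e : ℕ) (M : Matrix (Fin d) (Fin d) ℂ) :
    Matrix (Fin (d + e)) (Fin (d + e)) ℂ :=
  Matrix.of fun p q =>
    if h : (p : ℕ) < d ∧ (q : ℕ) < d then M ⟨p, h.1⟩ ⟨q, h.2⟩ else 0

lemma sld_entry {e : ℕ} (S D : Matrix (Fin 5) (Fin 5) ℂ)
    (hS : S = (1 / 3 : ℂ) • !![1, 0, 0, 0, 0; 0, 1, 0, 0, 0; 0, 0, 1, 0, 0;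
      0, 0, 0, 0, 0; 0, 0, 0, 0, 0])
    (L : Matrix (Fin (5 + e)) (Fin (5 + e)) ℂ)
    (h : zeroPad e D = (1 / 2 : ℂ) • (zeroPad e S * L + L * zeroPad e S))
    (i j : Fin (5 + e)) :
    zeroPad e D i j = 1 / 2 * ((if (i : ℕ) < 3 then 1 / 3 else 0)
      + (if (j : ℕ) < 3 then 1 / 3 else 0)) * L i j := by
  have hd : zeroPad e S = Matrix.diagonal
      (fun i : Fin (5 + e) => if (i : ℕ) < 3 then (1 / 3 : ℂ) else 0) := by
    subst hS
    ext p q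
    refine Fin.addCases (fun p => ?_) (fun p => ?_) p <;>
      refine Fin.addCases (fun q => ?_) (fun q => ?_) q
    · fin_cases p <;> fin_cases q <;> simp [zeroPad, Matrix.diagonal, Fin.ext_iff]
    · have := p.2
      simp [zeroPad, Matrix.diagonal, Fin.ext_iff]
      intros; omega
    · simp [zeroPad, Matrix.diagonal, Fin.ext_iff]
      intros; omega
    · simp [zeroPad, Matrix.diagonal, Fin.ext_iff]
      intros; omega
  rw [h, hd]
  simp only [Matrix.smul_apply, Matrix.add_apply, Matrix.diagonal_mul, Matrix.mul_diagonal,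
    smul_eq_mul]
  ring

lemma sld_left {e : ℕ} (S D : Matrix (Fin 5) (Fin 5) ℂ)
    (hS : S = (1 / 3 : ℂ) • !![1, 0, 0, 0, 0; 0, 1, 0, 0, 0; 0, 0, 1, 0, 0;
      0, 0, 0, 0, 0; 0, 0, 0, 0, 0])
    (L : Matrix (Fin (5 + e)) (Fin (5 + e)) ℂ)
    (h : zeroPad e D = (1 / 2 : ℂ) • (zeroPad e S * L + L * zeroPad e S))
    (i j : Fin 5) (hi : (i : ℕ) < 3) :
    L (Fin.castAdd e i) (Fin.castAdd e j) = (if (j : ℕ) < 3 then 3 else 6) * D i j := by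
  have := sld_entry S D hS L h (Fin.castAdd e i) (Fin.castAdd e j)
  simp only [zeroPad, Matrix.of_apply, Fin.val_castAdd, Fin.is_lt, and_self, dite_true, hi,
    if_true, Fin.eta] at this
  rw [this]
  split_ifs <;> ring

lemma sld_right {e : ℕ} (S D : Matrix (Fin 5) (Fin 5) ℂ)
    (hS : S = (1 / 3 : ℂ) • !![1, 0, 0, 0, 0; 0, 1, 0, 0, 0; 0, 0, 1, 0, 0;
      0, 0, 0, 0, 0; 0, 0, 0, 0, 0])
    (L : Matrix (Fin (5 + e)) (Fin (5 + e)) ℂ)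
    (h : zeroPad e D = (1 / 2 : ℂ) • (zeroPad e S * L + L * zeroPad e S))
    (i : Fin 5) (j : Fin e) (hi : (i : ℕ) < 3) :
    L (Fin.castAdd e i) (Fin.natAdd 5 j) = 0 := by
  have := sld_entry S D hS L h (Fin.castAdd e i) (Fin.natAdd 5 j)
  have h5 : ¬ (5 + (j : ℕ) < 3) := by omega
  simpa [zeroPad, hi, h5] using this

/-- Second example supporting Result A (Appendix D): for this rank-3 state in a
5-dimensional Hilbert space, no choice of SLD operators on any extended Hilbert space
commutes. -/
theorem appendixD_no_commuting_extension
    (S S1 S2 : Matrix (Fin 5) (Fin 5) ℂ)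
    (hS : S = (1 / 3 : ℂ) • !![1, 0, 0, 0, 0; 0, 1, 0, 0, 0; 0, 0, 1, 0, 0;
      0, 0, 0, 0, 0; 0, 0, 0, 0, 0])
    (hS1 : S1 = (1 / 3 : ℂ) • !![1, 0, 0, 1/2, 0; 0, 0, 0, 0, 0; 0, 0, -1, 0, 1/2;
      1/2, 0, 0, 0, 0; 0, 0, 1/2, 0, 0])
    (hS2 : S2 = (1 / 3 : ℂ) • !![0, 1, 0, 0, 1/2; 1, 0, 1, -1/2, 1/2;
      0, 1, 0, 1/2, 0; 0, -1/2, 1/2, 0, 0; 1/2, 1/2, 0, 0, 0]) :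
    ∀ (e : ℕ) (L1 L2 : Matrix (Fin (5 + e)) (Fin (5 + e)) ℂ),
      L1.IsHermitian → L2.IsHermitian →
      zeroPad e S1 = (1 / 2 : ℂ) • (zeroPad e S * L1 + L1 * zeroPad e S) →
      zeroPad e S2 = (1 / 2 : ℂ) • (zeroPad e S * L2 + L2 * zeroPad e S) →
      L1 * L2 ≠ L2 * L1 := by
  intro e L1 L2 hL1 hL2 h1 h2 hc
  have l1 := sld_left S S1 hS L1 h1
  have l2 := sld_left S S2 hS L2 h2
  have r1 := sld_right S S1 hS L1 h1
  have r2 := sld_right S S2 hS L2 h2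
  have key : ∀ i j : Fin 5, (i : ℕ) < 3 →
      ∑ k : Fin 5, L1 (Fin.castAdd e i) (Fin.castAdd e k) * L2 (Fin.castAdd e k) (Fin.castAdd e j)
      = ∑ k : Fin 5, L2 (Fin.castAdd e i) (Fin.castAdd e k)
          * L1 (Fin.castAdd e k) (Fin.castAdd e j) := by
    intro i j hi
    have := congrFun (congrFun hc (Fin.castAdd e i)) (Fin.castAdd e j)
    simpa only [Matrix.mul_apply, Fin.sum_univ_add, r1 i _ hi, r2 i _ hi, zero_mul,
      Finset.sum_const_zero, add_zero] using this
  have a03 := key 0 3 (by decide)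
  have a04 := key 0 4 (by decide)
  have a13 := key 1 3 (by decide)
  have a14 := key 1 4 (by decide)
  have a23 := key 2 3 (by decide)
  have a24 := key 2 4 (by decide)
  have c1 := hL1.apply (Fin.castAdd e 3) (Fin.castAdd e 4)
  have d1 := hL1.apply (Fin.castAdd e 3) (Fin.castAdd e 3)
  have e1 := hL1.apply (Fin.castAdd e 4) (Fin.castAdd e 4)
  have c2 := hL2.apply (Fin.castAdd e 3) (Fin.castAdd e 4)
  have d2 := hL2.apply (Fin.castAdd e 3) (Fin.castAdd e 3)
  simp only [Fin.sum_univ_five, l1 0 _ (by decide), l1 1 _ (by decide), l1 2 _ (by decide),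
    l2 0 _ (by decide), l2 1 _ (by decide), l2 2 _ (by decide)] at a03 a04 a13 a14 a23 a24
  generalize L1 (Fin.castAdd e 3) (Fin.castAdd e 3) = x33 at *
  generalize L1 (Fin.castAdd e 3) (Fin.castAdd e 4) = x34 at *
  generalize L1 (Fin.castAdd e 4) (Fin.castAdd e 3) = x43 at *
  generalize L1 (Fin.castAdd e 4) (Fin.castAdd e 4) = x44 at *
  generalize L2 (Fin.castAdd e 3) (Fin.castAdd e 3) = y33 at *
  generalize L2 (Fin.castAdd e 3) (Fin.castAdd e 4) = y34 at *
  generalize L2 (Fin.castAdd e 4) (Fin.castAdd e 3) = y43 at *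
  generalize L2 (Fin.castAdd e 4) (Fin.castAdd e 4) = y44 at *
  clear l1 l2 r1 r2 key h1 h2 hc hL1 hL2
  subst hS1 hS2
  simp at a03 a04 a13 a14 a23 a24
  have b03 := congrArg Complex.re a03
  have b04 := congrArg Complex.re a04
  have b13 := congrArg Complex.re a13
  have b14 := congrArg Complex.re a14
  have b23 := congrArg Complex.re a23
  have f1 := congrArg Complex.re c1
  have f2 := congrArg Complex.re c2
  simp at b03 b04 b13 b14 b23 f1 f2
  linarith
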